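/- arXiv:2011.11370 — 9 statements merged into one kernel-verified Lean document; each statement's English description precedes it below -/
import Mathlib

section
/- Let V₁, V₂ : [0,1] → ℝ be continuous with ∫₀¹ e^{−V₁(t)} dt = ∫₀¹ e^{−V₂(t)} dt. For j = 1,2 let û_j : [0,1] → ℝ be continuously differentiable with û_j(0) = U₀, û_j(1) = U₁, such that x ↦ e^{V_j(x)} û_j'(x) has zero derivative on (0,1). Then the output currents agree: μ_n * e^{V₁(1)} * û₁'(1) = μ_n * e^{V₂(1)} * û₂'(1) for any constant μ_n. In particular, two distinct continuous potentials with equal ∫₀¹ e^{−V} produce identical voltage-to-current data for all boundary values (U₀, U₁). -/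
/-- The outflow current times `∫ e^{-V}` is the voltage drop. -/
theorem current_mul_integral (V u u' : ℝ → ℝ)
    (hV : ContinuousOn V (Set.Icc 0 1))
    (hu : ∀ x ∈ Set.Icc (0:ℝ) 1, HasDerivWithinAt u (u' x) (Set.Icc 0 1) x)
    (hu' : ContinuousOn u' (Set.Icc 0 1))
    (hJ : ∀ x ∈ Set.Ioo (0:ℝ) 1, HasDerivAt (fun t => Real.exp (V t) * u' t) 0 x) :
    Real.exp (V 1) * u' 1 * (∫ t in (0:ℝ)..1, Real.exp (-V t)) = u 1 - u 0 := by
  have hc : ContinuousOn (fun t => Real.exp (V t) * u' t) (Set.Icc 0 1) := hV.rexp.mul hu'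
  have hconst : ∀ x ∈ Set.Icc (0:ℝ) 1, Real.exp (V x) * u' x = Real.exp (V 1) * u' 1 := by
    intro x hx
    rcases hx.2.eq_or_lt with h | h
    · rw [h]
    · obtain ⟨c, _, h2⟩ := exists_hasDerivAt_eq_slope (fun t => Real.exp (V t) * u' t)
        (fun _ => 0) h (hc.mono (Set.Icc_subset_Icc_left hx.1))
        (fun y hy => hJ y ⟨hx.1.trans_lt hy.1, hy.2⟩)
      have h3 : (1 - x) ≠ 0 := by linarith
      rw [eq_div_iff h3] at h2
      linarith
  have hF : (∫ t in (0:ℝ)..1, u' t) = u 1 - u 0 := by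
    apply intervalIntegral.integral_eq_sub_of_hasDerivAt_of_le zero_le_one
    · exact fun x hx => (hu x hx).continuousWithinAt
    · exact fun x hx => (hu x (Set.Ioo_subset_Icc_self hx)).hasDerivAt
        (Icc_mem_nhds hx.1 hx.2)
    · exact ContinuousOn.intervalIntegrable (by rwa [Set.uIcc_of_le zero_le_one])
  rw [← hF, ← intervalIntegral.integral_const_mul]
  apply intervalIntegral.integral_congr
  intro x hx
  rw [Set.uIcc_of_le zero_le_one] at hx
  have h1 : Real.exp (V x) * Real.exp (-V x) = 1 := by
    rw [← Real.exp_add]; simp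
  change Real.exp (V 1) * u' 1 * Real.exp (-V x) = u' x
  rw [← hconst x hx]
  linear_combination u' x * h1

/-- Two continuous potentials `V₁, V₂` on `[0,1]` with equal `∫₀¹ e^{-V}` produce
identical voltage-to-current data: if `u_j` solves `(e^{V_j} u_j')' = 0` with the same
boundary values `U₀, U₁`, then the outflow currents `μ_n e^{V_j(1)} u_j'(1)` agree. -/
theorem nonuniqueness_voltage_current_1d
    (V1 V2 u1 u2 u1' u2' : ℝ → ℝ) (U0 U1 μn : ℝ)
    (hV1 : ContinuousOn V1 (Set.Icc 0 1)) (hV2 : ContinuousOn V2 (Set.Icc 0 1))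
    (hIeq : (∫ t in (0:ℝ)..1, Real.exp (-V1 t)) = ∫ t in (0:ℝ)..1, Real.exp (-V2 t))
    (hu1 : ∀ x ∈ Set.Icc (0:ℝ) 1, HasDerivWithinAt u1 (u1' x) (Set.Icc 0 1) x)
    (hu1' : ContinuousOn u1' (Set.Icc 0 1))
    (hu10 : u1 0 = U0) (hu11 : u1 1 = U1)
    (hJ1 : ∀ x ∈ Set.Ioo (0:ℝ) 1,
      HasDerivAt (fun t => Real.exp (V1 t) * u1' t) 0 x)
    (hu2 : ∀ x ∈ Set.Icc (0:ℝ) 1, HasDerivWithinAt u2 (u2' x) (Set.Icc 0 1) x)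
    (hu2' : ContinuousOn u2' (Set.Icc 0 1))
    (hu20 : u2 0 = U0) (hu21 : u2 1 = U1)
    (hJ2 : ∀ x ∈ Set.Ioo (0:ℝ) 1,
      HasDerivAt (fun t => Real.exp (V2 t) * u2' t) 0 x) :
    μn * Real.exp (V1 1) * u1' 1 = μn * Real.exp (V2 1) * u2' 1 := by
  have h1 := current_mul_integral V1 u1 u1' hV1 hu1 hu1' hJ1
  have h2 := current_mul_integral V2 u2 u2' hV2 hu2 hu2' hJ2
  have hpos : 0 < ∫ t in (0:ℝ)..1, Real.exp (-V2 t) := by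
    apply intervalIntegral.intervalIntegral_pos_of_pos_on _ (fun x _ => Real.exp_pos _)
      zero_lt_one
    apply ContinuousOn.intervalIntegrable
    rw [Set.uIcc_of_le zero_le_one]
    exact hV2.neg.rexp
  rw [hIeq, hu10, hu11] at h1
  rw [hu20, hu21, ← h1] at h2
  have h3 := mul_right_cancel₀ hpos.ne' h2
  rw [mul_assoc, mul_assoc, h3]
end

section
/- Fix positive constants μ_n, μ_p and continuous functions V, Q, g : [0,1] → ℝ. Let û, v̂ ∈ C¹([0,1]) satisfy: the functions x ↦ μ_n e^{V(x)} û'(x) and x ↦ μ_p e^{−V(x)} v̂'(x) are differentiable on [0,1] with derivatives Q(x)(û(x)+v̂(x)) + g(x) in both cases, and û(0) = û(1) = v̂(0) = v̂(1) = 0. Let ũ, ṽ ∈ C¹([0,1]) satisfy: x ↦ μ_n e^{V(x)} ũ'(x) and x ↦ μ_p e^{−V(x)} ṽ'(x) are differentiable on [0,1] with derivatives Q(x)(ũ(x)−ṽ(x)) and Q(x)(ṽ(x)−ũ(x)) respectively, with ũ(0) = ṽ(0) = 1 and ũ(1) = ṽ(1) = 0. Then μ_n e^{V(0)} û'(0)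 − μ_p e^{−V(0)} v̂'(0) = ∫₀¹ (ṽ(x) − ũ(x)) g(x) dx. -/
/-- One-dimensional representation formula for the LBIC functional:
`μ_n e^{V(0)} û'(0) - μ_p e^{-V(0)} v̂'(0) = ∫₀¹ (ṽ - ũ) g`, where `(û, v̂)` solve the
linearized continuity equations with source `g` and homogeneous Dirichlet data, and
`(ũ, ṽ)` solve the flipped adjoint system. -/
theorem lbic_representation_1d (μn μp : ℝ) (hμn : 0 < μn) (hμp : 0 < μp)
    (V Q g : ℝ → ℝ)
    (hV : ContinuousOn V (Set.Icc 0 1)) (hQ : ContinuousOn Q (Set.Icc 0 1))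
    (hg : ContinuousOn g (Set.Icc 0 1))
    (u v u' v' : ℝ → ℝ)
    (hu : ∀ x ∈ Set.Icc (0:ℝ) 1, HasDerivWithinAt u (u' x) (Set.Icc 0 1) x)
    (hv : ∀ x ∈ Set.Icc (0:ℝ) 1, HasDerivWithinAt v (v' x) (Set.Icc 0 1) x)
    (hu' : ContinuousOn u' (Set.Icc 0 1)) (hv' : ContinuousOn v' (Set.Icc 0 1))
    (hJu : ∀ x ∈ Set.Icc (0:ℝ) 1,
      HasDerivWithinAt (fun t => μn * Real.exp (V t) * u' t)
        (Q x * (u x + v x) + g x) (Set.Icc 0 1) x)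
    (hJv : ∀ x ∈ Set.Icc (0:ℝ) 1,
      HasDerivWithinAt (fun t => μp * Real.exp (-V t) * v' t)
        (Q x * (u x + v x) + g x) (Set.Icc 0 1) x)
    (hu0 : u 0 = 0) (hu1 : u 1 = 0) (hv0 : v 0 = 0) (hv1 : v 1 = 0)
    (tu tv tu' tv' : ℝ → ℝ)
    (htu : ∀ x ∈ Set.Icc (0:ℝ) 1, HasDerivWithinAt tu (tu' x) (Set.Icc 0 1) x)
    (htv : ∀ x ∈ Set.Icc (0:ℝ) 1, HasDerivWithinAt tv (tv' x) (Set.Icc 0 1) x)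
    (htu' : ContinuousOn tu' (Set.Icc 0 1)) (htv' : ContinuousOn tv' (Set.Icc 0 1))
    (hJtu : ∀ x ∈ Set.Icc (0:ℝ) 1,
      HasDerivWithinAt (fun t => μn * Real.exp (V t) * tu' t)
        (Q x * (tu x - tv x)) (Set.Icc 0 1) x)
    (hJtv : ∀ x ∈ Set.Icc (0:ℝ) 1,
      HasDerivWithinAt (fun t => μp * Real.exp (-V t) * tv' t)
        (Q x * (tv x - tu x)) (Set.Icc 0 1) x)
    (htu0 : tu 0 = 1) (htv0 : tv 0 = 1) (htu1 : tu 1 = 0) (htv1 : tv 1 = 0) :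
    μn * Real.exp (V 0) * u' 0 - μp * Real.exp (-V 0) * v' 0 =
      ∫ x in (0:ℝ)..1, (tv x - tu x) * g x := by
  have hW : ∀ x ∈ Set.Icc (0:ℝ) 1, HasDerivWithinAt
      (fun t => tv t * (μp * Real.exp (-V t) * v' t) - v t * (μp * Real.exp (-V t) * tv' t)
        - (tu t * (μn * Real.exp (V t) * u' t) - u t * (μn * Real.exp (V t) * tu' t)))
      ((tv x - tu x) * g x) (Set.Icc 0 1) x := by
    intro x hx
    have h := (((htv x hx).mul (hJv x hx)).sub ((hv x hx).mul (hJtv x hx))).sub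
      (((htu x hx).mul (hJu x hx)).sub ((hu x hx).mul (hJtu x hx)))
    refine h.congr_deriv ?_
    ring
  have hint : IntervalIntegrable (fun x => (tv x - tu x) * g x) MeasureTheory.volume 0 1 := by
    apply ContinuousOn.intervalIntegrable
    rw [Set.uIcc_of_le zero_le_one]
    exact ContinuousOn.mul (ContinuousOn.sub (fun x hx => (htv x hx).continuousWithinAt)
      (fun x hx => (htu x hx).continuousWithinAt)) hg
  rw [intervalIntegral.integral_eq_sub_of_hasDerivAt_of_le zero_le_one
    (fun x hx => (hW x hx).continuousWithinAt)
    (fun x hx => (hW x (Set.Ioo_subset_Icc_self hx)).hasDerivAt (Icc_mem_nhds hx.1 hx.2)) hint]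
  simp only [hu0, hu1, hv0, hv1, htu0, htu1, htv0, htv1]
  ring
end

section
/- Fix positive constants μ_n, μ_p, Q₀ and a continuous potential V : [0,1] → ℝ. Let ũ, ṽ ∈ C¹([0,1]) be such that x ↦ μ_n e^{V(x)} ũ'(x) and x ↦ μ_p e^{−V(x)} ṽ'(x) are differentiable on [0,1] with (μ_n e^{V} ũ')' = Q₀ (ũ − ṽ) and (μ_p e^{−V} ṽ')' = Q₀ (ṽ − ũ), and ũ(0) = ṽ(0) = 1, ũ(1) = ṽ(1) = 0. Define i := ṽ − ũ, I(x) := ∫₀ˣ i(t) dt, Y(x) := e^{−V(x)}, c₁ := e^{V(0)} ũ'(0), c₂ := e^{−V(0)} ṽ'(0). Then for every x ∈ [0,1]: (c₁ − (Q₀/μ_n) I(x)) Y(x) + i'(x) − (c₂ + (Q₀/μ_p) I(x)) / Y(x) = 0, and moreover 1 + ∫₀¹ (c₁ − (Q₀/μ_n) I(x)) Y(x) dx = 0. -/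
theorem lbic_ftc (f f' : ℝ → ℝ)
    (hf : ∀ x ∈ Set.Icc (0:ℝ) 1, HasDerivWithinAt f (f' x) (Set.Icc 0 1) x)
    (hc : ContinuousOn f' (Set.Icc 0 1)) (x : ℝ) (hx : x ∈ Set.Icc (0:ℝ) 1) :
    (∫ t in (0:ℝ)..x, f' t) = f x - f 0 := by
  have hsub : Set.Icc (0:ℝ) x ⊆ Set.Icc 0 1 := Set.Icc_subset_Icc_right hx.2
  apply intervalIntegral.integral_eq_sub_of_hasDerivAt_of_le hx.1
  · exact fun t ht => ((hf t (hsub ht)).continuousWithinAt).mono hsub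
  · intro t ht
    exact (hf t (hsub ⟨ht.1.le, ht.2.le⟩)).hasDerivAt
      (Icc_mem_nhds ht.1 (lt_of_lt_of_le ht.2 hx.2))
  · apply ContinuousOn.intervalIntegrable
    rw [Set.uIcc_of_le hx.1]
    exact hc.mono hsub

/-- Necessity part of the attainability criterion for 1-D LBIC measurements:
with `i = ṽ - ũ`, `I(x) = ∫₀ˣ i`, `Y = e^{-V}`, `c₁ = e^{V(0)} ũ'(0)`,
`c₂ = e^{-V(0)} ṽ'(0)`, the quadratic equation
`(c₁ - (Q₀/μ_n) I) Y + i' - (c₂ + (Q₀/μ_p) I)/Y = 0` holds pointwise and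
`1 + ∫₀¹ (c₁ - (Q₀/μ_n) I) Y = 0`. -/
theorem lbic_attainability_necessity (μn μp Q0 : ℝ)
    (hμn : 0 < μn) (hμp : 0 < μp) (hQ0 : 0 < Q0)
    (V : ℝ → ℝ) (hV : ContinuousOn V (Set.Icc 0 1))
    (tu tv tu' tv' : ℝ → ℝ)
    (htu : ∀ x ∈ Set.Icc (0:ℝ) 1, HasDerivWithinAt tu (tu' x) (Set.Icc 0 1) x)
    (htv : ∀ x ∈ Set.Icc (0:ℝ) 1, HasDerivWithinAt tv (tv' x) (Set.Icc 0 1) x)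
    (htu' : ContinuousOn tu' (Set.Icc 0 1)) (htv' : ContinuousOn tv' (Set.Icc 0 1))
    (hJtu : ∀ x ∈ Set.Icc (0:ℝ) 1,
      HasDerivWithinAt (fun t => μn * Real.exp (V t) * tu' t)
        (Q0 * (tu x - tv x)) (Set.Icc 0 1) x)
    (hJtv : ∀ x ∈ Set.Icc (0:ℝ) 1,
      HasDerivWithinAt (fun t => μp * Real.exp (-V t) * tv' t)
        (Q0 * (tv x - tu x)) (Set.Icc 0 1) x)
    (htu0 : tu 0 = 1) (htv0 : tv 0 = 1) (htu1 : tu 1 = 0) (htv1 : tv 1 = 0)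
    (c1 c2 : ℝ) (hc1 : c1 = Real.exp (V 0) * tu' 0) (hc2 : c2 = Real.exp (-V 0) * tv' 0) :
    (∀ x ∈ Set.Icc (0:ℝ) 1,
      (c1 - Q0 / μn * ∫ t in (0:ℝ)..x, (tv t - tu t)) * Real.exp (-V x)
        + (tv' x - tu' x)
        - (c2 + Q0 / μp * ∫ t in (0:ℝ)..x, (tv t - tu t)) / Real.exp (-V x) = 0) ∧
    1 + (∫ x in (0:ℝ)..1,
      (c1 - Q0 / μn * ∫ t in (0:ℝ)..x, (tv t - tu t)) * Real.exp (-V x)) = 0 := by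
  have cu : ContinuousOn tu (Set.Icc 0 1) := fun t ht => (htu t ht).continuousWithinAt
  have cv : ContinuousOn tv (Set.Icc 0 1) := fun t ht => (htv t ht).continuousWithinAt
  have hu : ∀ x ∈ Set.Icc (0:ℝ) 1,
      (c1 - Q0 / μn * ∫ t in (0:ℝ)..x, (tv t - tu t)) * Real.exp (-V x) = tu' x := by
    intro x hx
    have h := lbic_ftc _ _ hJtu (continuousOn_const.mul (cu.sub cv)) x hx
    have e : (∫ t in (0:ℝ)..x, Q0 * (tu t - tv t))
        = -Q0 * ∫ t in (0:ℝ)..x, (tv t - tu t) := by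
      rw [← intervalIntegral.integral_const_mul]
      congr 1
      ext t
      ring
    rw [e] at h
    rw [hc1, Real.exp_neg]
    have := Real.exp_pos (V x)
    field_simp
    linarith
  have hv : ∀ x ∈ Set.Icc (0:ℝ) 1,
      (c2 + Q0 / μp * ∫ t in (0:ℝ)..x, (tv t - tu t)) / Real.exp (-V x) = tv' x := by
    intro x hx
    have h := lbic_ftc _ _ hJtv (continuousOn_const.mul (cv.sub cu)) x hx
    rw [intervalIntegral.integral_const_mul] at h
    rw [hc2, div_eq_iff (Real.exp_pos _).ne']
    apply mul_left_cancel₀ hμp.ne'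
    have e : μp * (Q0 / μp * ∫ t in (0:ℝ)..x, (tv t - tu t))
        = Q0 * ∫ t in (0:ℝ)..x, (tv t - tu t) := by
      field_simp
    rw [mul_add, e]
    linarith
  refine ⟨fun x hx => ?_, ?_⟩
  · rw [hu x hx, hv x hx]
    ring
  · have h : (∫ x in (0:ℝ)..1,
        (c1 - Q0 / μn * ∫ t in (0:ℝ)..x, (tv t - tu t)) * Real.exp (-V x))
        = ∫ x in (0:ℝ)..1, tu' x := by
      apply intervalIntegral.integral_congr
      intro x hx
      rw [Set.uIcc_of_le zero_le_one] at hx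
      exact hu x hx
    rw [h, lbic_ftc tu tu' htu htu' 1 (by simp), htu0, htu1]
    norm_num
end

section
/- Fix positive constants μ_n, μ_p, Q₀ and a continuous potential V : [0,1] → ℝ. Let ũ, ṽ ∈ C¹([0,1]) be such that x ↦ μ_n e^{V(x)} ũ'(x) and x ↦ μ_p e^{−V(x)} ṽ'(x) are differentiable on [0,1] with (μ_n e^{V} ũ')' = Q₀ (ũ − ṽ) and (μ_p e^{−V} ṽ')' = Q₀ (ṽ − ũ), and ũ(0) = ṽ(0) = 1, ũ(1) = ṽ(1) = 0. Then the constants c₁ := e^{V(0)} ũ'(0) and c₂ := e^{−V(0)} ṽ'(0) are nonpositive: c₁ ≤ 0 and c₂ ≤ 0. -/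
lemma lbic_step (p u v u' : ℝ → ℝ) (Q0 : ℝ) (hQ0 : 0 < Q0)
    (hp : ∀ x, 0 < p x)
    (hu : ∀ x ∈ Set.Icc (0:ℝ) 1, HasDerivWithinAt u (u' x) (Set.Icc 0 1) x)
    (hJ : ∀ x ∈ Set.Icc (0:ℝ) 1,
      HasDerivWithinAt (fun t => p t * u' t) (Q0 * (u x - v x)) (Set.Icc 0 1) x)
    (x : ℝ) (hx : x ∈ Set.Ioo (0:ℝ) 1) (hmax : ∀ y ∈ Set.Icc (0:ℝ) 1, u y ≤ u x)
    (h0 : u' x = 0) (hw : v x < u x) : False := by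
  have hd : HasDerivAt (fun t => p t * u' t) (Q0 * (u x - v x)) x :=
    (hJ x ⟨hx.1.le, hx.2.le⟩).hasDerivAt (Icc_mem_nhds hx.1 hx.2)
  have hpos : 0 < deriv (fun t => p t * u' t) x := by
    rw [hd.deriv]; exact mul_pos hQ0 (sub_pos.2 hw)
  have hs := eventually_nhdsWithin_sign_eq_of_deriv_pos hpos (by simp [h0])
  rw [Metric.eventually_nhds_iff] at hs
  obtain ⟨e, he, hs⟩ := hs
  obtain ⟨z, hz1, hz2⟩ := exists_between (lt_min (show x < x + e by linarith) hx.2)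
  have hz3 := lt_min_iff.1 hz2
  have hmono : StrictMonoOn u (Set.Icc x z) := by
    apply strictMonoOn_of_deriv_pos (convex_Icc _ _)
    · intro y hy
      have hy' : y ∈ Set.Icc (0:ℝ) 1 := ⟨hx.1.le.trans hy.1, hy.2.trans hz3.2.le⟩
      exact (hu y hy').continuousWithinAt.mono
        (Set.Icc_subset_Icc hx.1.le hz3.2.le)
    · intro y hy
      rw [interior_Icc] at hy
      have hy0 : 0 < y := hx.1.trans hy.1
      have hy1 : y < 1 := hy.2.trans hz3.2
      rw [((hu y ⟨hy0.le, hy1.le⟩).hasDerivAt (Icc_mem_nhds hy0 hy1)).deriv]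
      have h := @hs y (by rw [Real.dist_eq, abs_of_pos (sub_pos.2 hy.1)]; linarith [hy.2, hz3.1])
      rw [sign_pos (sub_pos.2 hy.1), sign_eq_one_iff] at h
      exact (mul_pos_iff_of_pos_left (hp y)).1 h
  have h1 := hmono (Set.left_mem_Icc.2 hz1.le) (Set.right_mem_Icc.2 hz1.le) hz1
  have h2 := hmax z ⟨(hx.1.trans hz1).le, hz3.2.le⟩
  linarith

lemma lbic_crit (u u' : ℝ → ℝ)
    (hu : ∀ x ∈ Set.Icc (0:ℝ) 1, HasDerivWithinAt u (u' x) (Set.Icc 0 1) x)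
    (x : ℝ) (hx : x ∈ Set.Ioo (0:ℝ) 1) (hmax : ∀ y ∈ Set.Icc (0:ℝ) 1, u y ≤ u x) :
    u' x = 0 := by
  have hn := Icc_mem_nhds hx.1 hx.2
  have hl : IsLocalMax u x := Filter.mem_of_superset hn hmax
  exact hl.hasDerivAt_eq_zero ((hu x ⟨hx.1.le, hx.2.le⟩).hasDerivAt hn)

lemma lbic_max (p q u v u' v' : ℝ → ℝ) (Q0 : ℝ) (hQ0 : 0 < Q0)
    (hp : ∀ x, 0 < p x)
    (hu : ∀ x ∈ Set.Icc (0:ℝ) 1, HasDerivWithinAt u (u' x) (Set.Icc 0 1) x)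
    (hv : ∀ x ∈ Set.Icc (0:ℝ) 1, HasDerivWithinAt v (v' x) (Set.Icc 0 1) x)
    (hJ : ∀ x ∈ Set.Icc (0:ℝ) 1,
      HasDerivWithinAt (fun t => p t * u' t) (Q0 * (u x - v x)) (Set.Icc 0 1) x)
    (hC : ∀ x ∈ Set.Icc (0:ℝ) 1, p x * u' x + q x * v' x ≠ 0)
    (hu0 : u 0 = 1) (hu1 : u 1 = 0)
    (x : ℝ) (hx : x ∈ Set.Icc (0:ℝ) 1) (hmu : ∀ y ∈ Set.Icc (0:ℝ) 1, u y ≤ u x)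
    (hmv : ∀ y ∈ Set.Icc (0:ℝ) 1, v y ≤ u x) : u x ≤ 1 := by
  by_contra! h
  have h0 : x ≠ 0 := by rintro rfl; linarith
  have h1 : x ≠ 1 := by rintro rfl; linarith
  have hx' : x ∈ Set.Ioo (0:ℝ) 1 := ⟨lt_of_le_of_ne hx.1 h0.symm, lt_of_le_of_ne hx.2 h1⟩
  have hc := lbic_crit u u' hu x hx' hmu
  rcases lt_or_eq_of_le (hmv x hx) with hlt | heq
  · exact lbic_step p u v u' Q0 hQ0 hp hu hJ x hx' hmu hc hlt
  · have hc' := lbic_crit v v' hv x hx' (fun y hy => heq ▸ hmv y hy)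
    exact hC x hx (by simp [hc, hc'])

lemma lbic_bdry (u u' : ℝ → ℝ)
    (hu : ∀ x ∈ Set.Icc (0:ℝ) 1, HasDerivWithinAt u (u' x) (Set.Icc 0 1) x)
    (hu0 : u 0 = 1) (h : ∀ x ∈ Set.Icc (0:ℝ) 1, u x ≤ 1) : u' 0 ≤ 0 := by
  have h1 := (hu 0 (by simp)).mono (Set.Ioc_subset_Icc_self)
  rw [hasDerivWithinAt_iff_tendsto_slope' (by simp)] at h1
  haveI : (nhdsWithin (0:ℝ) (Set.Ioc 0 1)).NeBot := by
    rw [nhdsWithin_Ioc_eq_nhdsGT one_pos]; infer_instance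
  refine le_of_tendsto h1 ?_
  filter_upwards [self_mem_nhdsWithin] with y hy
  rw [slope_def_field]
  apply div_nonpos_of_nonpos_of_nonneg
  · linarith [h y ⟨hy.1.le, hy.2⟩]
  · linarith [hy.1]

lemma lbic_aux (p q u v u' v' : ℝ → ℝ) (Q0 : ℝ) (hQ0 : 0 < Q0)
    (hp : ∀ x, 0 < p x) (hq : ∀ x, 0 < q x)
    (hu : ∀ x ∈ Set.Icc (0:ℝ) 1, HasDerivWithinAt u (u' x) (Set.Icc 0 1) x)
    (hv : ∀ x ∈ Set.Icc (0:ℝ) 1, HasDerivWithinAt v (v' x) (Set.Icc 0 1) x)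
    (hJ : ∀ x ∈ Set.Icc (0:ℝ) 1,
      HasDerivWithinAt (fun t => p t * u' t) (Q0 * (u x - v x)) (Set.Icc 0 1) x)
    (hK : ∀ x ∈ Set.Icc (0:ℝ) 1,
      HasDerivWithinAt (fun t => q t * v' t) (Q0 * (v x - u x)) (Set.Icc 0 1) x)
    (hu0 : u 0 = 1) (hv0 : v 0 = 1) (hu1 : u 1 = 0) (hv1 : v 1 = 0) :
    u' 0 ≤ 0 ∧ v' 0 ≤ 0 := by
  have m0 : (0:ℝ) ∈ Set.Icc (0:ℝ) 1 := by simp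
  have m1 : (1:ℝ) ∈ Set.Icc (0:ℝ) 1 := by simp
  have hconst : ∀ x ∈ Set.Icc (0:ℝ) 1,
      p x * u' x + q x * v' x = p 0 * u' 0 + q 0 * v' 0 := by
    have hd : ∀ x ∈ Set.Icc (0:ℝ) 1,
        HasDerivWithinAt (fun t => p t * u' t + q t * v' t) 0 (Set.Icc 0 1) x := by
      intro x hx
      refine ((hJ x hx).add (hK x hx)).congr_deriv ?_
      ring
    intro x hx
    have := (convex_Icc (0:ℝ) 1).norm_image_sub_le_of_norm_hasDerivWithin_le
      (C := 0) hd (by simp) m0 hx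
    simpa [sub_eq_zero] using this
  by_cases hC : p 0 * u' 0 + q 0 * v' 0 = 0
  · have hF : ∀ x ∈ Set.Icc (0:ℝ) 1, HasDerivWithinAt (fun t => p t * u' t * (u t - v t))
        (Q0 * (u x - v x) ^ 2 + p x * u' x ^ 2 + q x * v' x ^ 2) (Set.Icc 0 1) x := by
      intro x hx
      refine ((hJ x hx).mul ((hu x hx).sub (hv x hx))).congr_deriv ?_
      have := hconst x hx
      rw [hC] at this
      simp only [Pi.sub_apply]
      linear_combination (-v' x) * this
    have hmono : MonotoneOn (fun t => p t * u' t * (u t - v t)) (Set.Icc 0 1) := by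
      apply monotoneOn_of_hasDerivWithinAt_nonneg (convex_Icc _ _)
        (fun x hx => (hF x hx).continuousWithinAt)
        (fun x hx => (hF x (interior_subset hx)).mono interior_subset)
      intro x _
      have := hp x
      have := hq x
      positivity
    have hz : ∀ x ∈ Set.Icc (0:ℝ) 1, p x * u' x * (u x - v x) = 0 := by
      intro x hx
      have a := hmono m0 hx hx.1
      have b := hmono hx m1 hx.2
      simp only [hu0, hv0, hu1, hv1, sub_self, mul_zero] at a b
      exact le_antisymm b a
    have hd0 : HasDerivWithinAt (fun t => p t * u' t * (u t - v t)) 0 (Set.Icc 0 1) 0 :=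
      (hasDerivWithinAt_const (0:ℝ) (Set.Icc (0:ℝ) 1) (0:ℝ)).congr hz (hz 0 m0)
    have heq := (uniqueDiffOn_Icc (zero_lt_one' ℝ) 0 m0).eq_deriv _ (hF 0 m0) hd0
    rw [hu0, hv0] at heq
    have a := mul_nonneg (hp 0).le (sq_nonneg (u' 0))
    have b := mul_nonneg (hq 0).le (sq_nonneg (v' 0))
    have a0 : p 0 * u' 0 ^ 2 = 0 := by linarith
    have b0 : q 0 * v' 0 ^ 2 = 0 := by linarith
    have a1 : u' 0 = 0 := by simpa [(hp 0).ne'] using a0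
    have b1 : v' 0 = 0 := by simpa [(hq 0).ne'] using b0
    exact ⟨a1.le, b1.le⟩
  · have hC' : ∀ x ∈ Set.Icc (0:ℝ) 1, p x * u' x + q x * v' x ≠ 0 :=
      fun x hx => by rw [hconst x hx]; exact hC
    have hC'' : ∀ x ∈ Set.Icc (0:ℝ) 1, q x * v' x + p x * u' x ≠ 0 :=
      fun x hx => by rw [add_comm]; exact hC' x hx
    obtain ⟨a, ha, hamax⟩ := isCompact_Icc.exists_isMaxOn ⟨0, m0⟩
      (fun x hx => (hu x hx).continuousWithinAt)
    obtain ⟨b, hb, hbmax⟩ := isCompact_Icc.exists_isMaxOn ⟨0, m0⟩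
      (fun x hx => (hv x hx).continuousWithinAt)
    have ha' : ∀ y ∈ Set.Icc (0:ℝ) 1, u y ≤ u a := fun y hy => hamax hy
    have hb' : ∀ y ∈ Set.Icc (0:ℝ) 1, v y ≤ v b := fun y hy => hbmax hy
    have hab : u a ≤ 1 ∧ v b ≤ 1 := by
      rcases le_total (v b) (u a) with h | h
      · have := lbic_max p q u v u' v' Q0 hQ0 hp hu hv hJ hC' hu0 hu1 a ha ha'
          (fun y hy => (hb' y hy).trans h)
        exact ⟨this, h.trans this⟩
      · have := lbic_max q p v u v' u' Q0 hQ0 hq hv hu hK hC'' hv0 hv1 b hb hb'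
          (fun y hy => (ha' y hy).trans h)
        exact ⟨h.trans this, this⟩
    exact ⟨lbic_bdry u u' hu hu0 (fun x hx => (ha' x hx).trans hab.1),
      lbic_bdry v v' hv hv0 (fun x hx => (hb' x hx).trans hab.2)⟩

/-- For the 1-D LBIC system, the constants `c₁ = e^{V(0)} ũ'(0)` and
`c₂ = e^{-V(0)} ṽ'(0)` are nonpositive. -/
theorem lbic_constants_nonpositive (μn μp Q0 : ℝ)
    (hμn : 0 < μn) (hμp : 0 < μp) (hQ0 : 0 < Q0)
    (V : ℝ → ℝ) (hV : ContinuousOn V (Set.Icc 0 1))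
    (tu tv tu' tv' : ℝ → ℝ)
    (htu : ∀ x ∈ Set.Icc (0:ℝ) 1, HasDerivWithinAt tu (tu' x) (Set.Icc 0 1) x)
    (htv : ∀ x ∈ Set.Icc (0:ℝ) 1, HasDerivWithinAt tv (tv' x) (Set.Icc 0 1) x)
    (htu' : ContinuousOn tu' (Set.Icc 0 1)) (htv' : ContinuousOn tv' (Set.Icc 0 1))
    (hJtu : ∀ x ∈ Set.Icc (0:ℝ) 1,
      HasDerivWithinAt (fun t => μn * Real.exp (V t) * tu' t)
        (Q0 * (tu x - tv x)) (Set.Icc 0 1) x)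
    (hJtv : ∀ x ∈ Set.Icc (0:ℝ) 1,
      HasDerivWithinAt (fun t => μp * Real.exp (-V t) * tv' t)
        (Q0 * (tv x - tu x)) (Set.Icc 0 1) x)
    (htu0 : tu 0 = 1) (htv0 : tv 0 = 1) (htu1 : tu 1 = 0) (htv1 : tv 1 = 0) :
    Real.exp (V 0) * tu' 0 ≤ 0 ∧ Real.exp (-V 0) * tv' 0 ≤ 0 := by
  have h := lbic_aux (fun t => μn * Real.exp (V t)) (fun t => μp * Real.exp (-V t)) tu tv tu' tv'
    Q0 hQ0 (fun x => mul_pos hμn (Real.exp_pos _)) (fun x => mul_pos hμp (Real.exp_pos _))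
    htu htv hJtu hJtv htu0 htv0 htu1 htv1
  exact ⟨mul_nonpos_of_nonneg_of_nonpos (Real.exp_pos _).le h.1,
    mul_nonpos_of_nonneg_of_nonpos (Real.exp_pos _).le h.2⟩
end

section
/- Fix positive constants μ_n, μ_p, Q₀. Let i ∈ C¹([0,1]) satisfy i(0) = i(1) = 0, set I(x) := ∫₀ˣ i(t) dt, and let Y : [0,1] → ℝ be continuous with Y(x) > 0 for all x. Suppose there exist constants c₁, c₂ such that for all x ∈ [0,1], (c₁ − (Q₀/μ_n) I(x)) Y(x) + i'(x) − (c₂ + (Q₀/μ_p) I(x)) / Y(x) = 0, and 1 + ∫₀¹ (c₁ − (Q₀/μ_n) I(x)) Y(x) dx = 0. Define V(x) := −ln Y(x), û(x) := 1 + ∫₀ˣ (c₁ − (Q₀/μ_n) I(t)) Y(t) dt, and v̂(x) := 1 + ∫₀ˣ (c₂ + (Q₀/μ_p) I(t)) / Y(t) dt. Then û, v̂ ∈ C¹([0,1]), the functions x ↦ μ_n e^{V(x)} û'(x) and x ↦ μ_p e^{−V(x)} v̂'(x) are differentiable with (μ_n e^{V} û')' = Q₀ (û − v̂) and (μ_p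 e^{−V} v̂')' = Q₀ (v̂ − û), the boundary conditions û(0) = v̂(0) = 1, û(1) = v̂(1) = 0 hold, and v̂(x) − û(x) = i(x) for all x ∈ [0,1]. -/
theorem lbic_ftc_s9 (f : ℝ → ℝ) (hf : ContinuousOn f (Set.Icc 0 1)) :
    ∀ x ∈ Set.Icc (0:ℝ) 1,
      HasDerivWithinAt (fun y => ∫ t in (0:ℝ)..y, f t) (f x) (Set.Icc 0 1) x := by
  intro x hx
  have h01 : (0:ℝ) ≤ 1 := zero_le_one
  have hg : Continuous (Set.IccExtend h01 ((Set.Icc (0:ℝ) 1).restrict f)) :=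
    (continuousOn_iff_continuous_restrict.1 hf).Icc_extend'
  have hgf : ∀ y ∈ Set.Icc (0:ℝ) 1,
      Set.IccExtend h01 ((Set.Icc (0:ℝ) 1).restrict f) y = f y := by
    intro y hy
    rw [Set.IccExtend_of_mem _ _ hy]
    rfl
  have hd := (hg.integral_hasStrictDerivAt 0 x).hasDerivAt.hasDerivWithinAt (s := Set.Icc (0:ℝ) 1)
  rw [hgf x hx] at hd
  have key : ∀ y ∈ Set.Icc (0:ℝ) 1, (∫ t in (0:ℝ)..y, f t)
      = ∫ t in (0:ℝ)..y, Set.IccExtend h01 ((Set.Icc (0:ℝ) 1).restrict f) t := by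
    intro y hy
    apply intervalIntegral.integral_congr
    intro t ht
    rw [Set.uIcc_of_le hy.1] at ht
    exact (hgf t ⟨ht.1, ht.2.trans hy.2⟩).symm
  exact hd.congr key (key x hx)

/-- Sufficiency part of the attainability criterion for 1-D LBIC measurements:
a positive continuous solution `Y` of the pointwise quadratic equation together with
the integral constraint yields a solution `(û, v̂)` of the LBIC system with potential
`V = -ln Y` realizing the measurement `i = v̂ - û`. -/
theorem lbic_attainability_sufficiency (μn μp Q0 : ℝ)
    (hμn : 0 < μn) (hμp : 0 < μp) (hQ0 : 0 < Q0)
    (i i' : ℝ → ℝ)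
    (hi : ∀ x ∈ Set.Icc (0:ℝ) 1, HasDerivWithinAt i (i' x) (Set.Icc 0 1) x)
    (hi' : ContinuousOn i' (Set.Icc 0 1))
    (hi0 : i 0 = 0) (hi1 : i 1 = 0)
    (Y : ℝ → ℝ) (hY : ContinuousOn Y (Set.Icc 0 1))
    (hYpos : ∀ x ∈ Set.Icc (0:ℝ) 1, 0 < Y x)
    (c1 c2 : ℝ)
    (hquad : ∀ x ∈ Set.Icc (0:ℝ) 1,
      (c1 - Q0 / μn * ∫ t in (0:ℝ)..x, i t) * Y x + i' x
        - (c2 + Q0 / μp * ∫ t in (0:ℝ)..x, i t) / Y x = 0)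
    (hint : 1 + (∫ x in (0:ℝ)..1,
      (c1 - Q0 / μn * ∫ t in (0:ℝ)..x, i t) * Y x) = 0)
    (V u v : ℝ → ℝ)
    (hV : ∀ x, V x = -Real.log (Y x))
    (hu : ∀ x, u x = 1 + ∫ t in (0:ℝ)..x,
      (c1 - Q0 / μn * ∫ s in (0:ℝ)..t, i s) * Y t)
    (hv : ∀ x, v x = 1 + ∫ t in (0:ℝ)..x,
      (c2 + Q0 / μp * ∫ s in (0:ℝ)..t, i s) / Y t) :
    (∀ x ∈ Set.Icc (0:ℝ) 1,
      HasDerivWithinAt u ((c1 - Q0 / μn * ∫ t in (0:ℝ)..x, i t) * Y x)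
        (Set.Icc 0 1) x) ∧
    (∀ x ∈ Set.Icc (0:ℝ) 1,
      HasDerivWithinAt v ((c2 + Q0 / μp * ∫ t in (0:ℝ)..x, i t) / Y x)
        (Set.Icc 0 1) x) ∧
    ContinuousOn (fun x => (c1 - Q0 / μn * ∫ t in (0:ℝ)..x, i t) * Y x)
      (Set.Icc 0 1) ∧
    ContinuousOn (fun x => (c2 + Q0 / μp * ∫ t in (0:ℝ)..x, i t) / Y x)
      (Set.Icc 0 1) ∧
    (∀ x ∈ Set.Icc (0:ℝ) 1,
      HasDerivWithinAt
        (fun t => μn * Real.exp (V t) * ((c1 - Q0 / μn * ∫ s in (0:ℝ)..t, i s) * Y t))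
        (Q0 * (u x - v x)) (Set.Icc 0 1) x) ∧
    (∀ x ∈ Set.Icc (0:ℝ) 1,
      HasDerivWithinAt
        (fun t => μp * Real.exp (-V t) * ((c2 + Q0 / μp * ∫ s in (0:ℝ)..t, i s) / Y t))
        (Q0 * (v x - u x)) (Set.Icc 0 1) x) ∧
    u 0 = 1 ∧ v 0 = 1 ∧ u 1 = 0 ∧ v 1 = 0 ∧
    (∀ x ∈ Set.Icc (0:ℝ) 1, v x - u x = i x) := by
  have hic : ContinuousOn i (Set.Icc 0 1) := fun x hx => (hi x hx).continuousWithinAt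
  have hI := lbic_ftc_s9 i hic
  have hIc : ContinuousOn (fun x => ∫ t in (0:ℝ)..x, i t) (Set.Icc 0 1) :=
    fun x hx => (hI x hx).continuousWithinAt
  have hfc : ContinuousOn (fun x => (c1 - Q0 / μn * ∫ t in (0:ℝ)..x, i t) * Y x)
      (Set.Icc 0 1) := (continuousOn_const.sub (continuousOn_const.mul hIc)).mul hY
  have hgc : ContinuousOn (fun x => (c2 + Q0 / μp * ∫ t in (0:ℝ)..x, i t) / Y x)
      (Set.Icc 0 1) := (continuousOn_const.add (continuousOn_const.mul hIc)).div hY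
        (fun x hx => (hYpos x hx).ne')
  have hdiff : ∀ x ∈ Set.Icc (0:ℝ) 1, v x - u x = i x := by
    intro x hx
    have hsub : Set.Icc 0 x ⊆ Set.Icc (0:ℝ) 1 := Set.Icc_subset_Icc_right hx.2
    have e1 : (∫ t in (0:ℝ)..x, i' t) = i x - i 0 := by
      apply intervalIntegral.integral_eq_sub_of_hasDerivAt_of_le hx.1 (hic.mono hsub)
      · intro t ht
        exact (hi t (hsub ⟨ht.1.le, ht.2.le⟩)).hasDerivAt
          (Icc_mem_nhds ht.1 (ht.2.trans_le hx.2))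
      · exact (hi'.mono hsub).intervalIntegrable_of_Icc hx.1
    rw [hu, hv, add_sub_add_left_eq_sub, ← intervalIntegral.integral_sub
      ((hgc.mono hsub).intervalIntegrable_of_Icc hx.1)
      ((hfc.mono hsub).intervalIntegrable_of_Icc hx.1)]
    rw [hi0, sub_zero] at e1
    rw [← e1]
    apply intervalIntegral.integral_congr
    intro t ht
    rw [Set.uIcc_of_le hx.1] at ht
    have := hquad t (hsub ht)
    simp only
    linarith
  have hu1 : u 1 = 0 := by rw [hu]; exact hint
  refine ⟨?_, ?_, hfc, hgc, ?_, ?_, by simp [hu], by simp [hv], hu1, ?_, hdiff⟩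
  · intro x hx
    rw [funext hu]
    exact (lbic_ftc_s9 _ hfc x hx).const_add 1
  · intro x hx
    rw [funext hv]
    exact (lbic_ftc_s9 _ hgc x hx).const_add 1
  · intro x hx
    have h := (((hI x hx).const_mul (Q0 / μn)).const_sub c1).const_mul μn
    have e : μn * -(Q0 / μn * i x) = Q0 * (u x - v x) := by
      rw [← hdiff x hx]; field_simp; ring
    rw [e] at h
    have key : ∀ t ∈ Set.Icc (0:ℝ) 1,
        μn * Real.exp (V t) * ((c1 - Q0 / μn * ∫ s in (0:ℝ)..t, i s) * Y t)
          = μn * (c1 - Q0 / μn * ∫ s in (0:ℝ)..t, i s) := by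
      intro t ht
      have hp := hYpos t ht
      rw [hV, Real.exp_neg, Real.exp_log hp]
      generalize (c1 - Q0 / μn * ∫ s in (0:ℝ)..t, i s) = a
      field_simp
    exact h.congr key (key x hx)
  · intro x hx
    have h := (((hI x hx).const_mul (Q0 / μp)).const_add c2).const_mul μp
    have e : μp * (Q0 / μp * i x) = Q0 * (v x - u x) := by
      rw [← hdiff x hx]; field_simp
    rw [e] at h
    have key : ∀ t ∈ Set.Icc (0:ℝ) 1,
        μp * Real.exp (-V t) * ((c2 + Q0 / μp * ∫ s in (0:ℝ)..t, i s) / Y t)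
          = μp * (c2 + Q0 / μp * ∫ s in (0:ℝ)..t, i s) := by
      intro t ht
      have hp := hYpos t ht
      rw [hV, neg_neg, Real.exp_log hp]
      generalize (c2 + Q0 / μp * ∫ s in (0:ℝ)..t, i s) = a
      field_simp
    exact h.congr key (key x hx)
  · have := hdiff 1 (by simp)
    linarith
end

section
/- Let a, b : [0,1] → ℝ be continuous with a(x) < 0 and b(x) < 0 for all x, let i ∈ C¹([0,1]) with i(0) = i(1) = 0, and let Y : [0,1] → ℝ be continuous with Y(x) > 0 satisfying a(x) Y(x)² + i'(x) Y(x) − b(x) = 0 for all x ∈ [0,1]. Then 1 + ∫₀¹ a(x) Y(x) dx = 0 holds if and only if (1/2) ∫₀¹ sqrt( i'(x)² + 4 a(x) b(x) ) dx = 1. -/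
/-- The integral constraint `1 + ∫₀¹ aY = 0` in the LBIC attainability criterion is
equivalent to the vanishing of the least-squares component
`J₁ = (1/2)∫₀¹ sqrt(i'² + 4ab) - 1`, given that `Y > 0` solves the pointwise quadratic
equation `a Y² + i' Y - b = 0` with `a, b < 0` and `i(0) = i(1) = 0`. -/
theorem lbic_integral_constraint_iff (a b i i' Y : ℝ → ℝ)
    (ha : ContinuousOn a (Set.Icc 0 1)) (hb : ContinuousOn b (Set.Icc 0 1))
    (haneg : ∀ x ∈ Set.Icc (0:ℝ) 1, a x < 0)
    (hbneg : ∀ x ∈ Set.Icc (0:ℝ) 1, b x < 0)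
    (hi : ∀ x ∈ Set.Icc (0:ℝ) 1, HasDerivWithinAt i (i' x) (Set.Icc 0 1) x)
    (hi' : ContinuousOn i' (Set.Icc 0 1))
    (hi0 : i 0 = 0) (hi1 : i 1 = 0)
    (hY : ContinuousOn Y (Set.Icc 0 1))
    (hYpos : ∀ x ∈ Set.Icc (0:ℝ) 1, 0 < Y x)
    (hquad : ∀ x ∈ Set.Icc (0:ℝ) 1, a x * Y x ^ 2 + i' x * Y x - b x = 0) :
    (1 + (∫ x in (0:ℝ)..1, a x * Y x) = 0) ↔
      (1 / 2) * (∫ x in (0:ℝ)..1, Real.sqrt (i' x ^ 2 + 4 * a x * b x)) = 1 := by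
  have hI : IntervalIntegrable i' MeasureTheory.volume 0 1 :=
    hi'.intervalIntegrable_of_Icc zero_le_one
  have hA : IntervalIntegrable (fun x => a x * Y x) MeasureTheory.volume 0 1 :=
    (ha.mul hY).intervalIntegrable_of_Icc zero_le_one
  have h0 : (∫ x in (0:ℝ)..1, i' x) = 0 := by
    rw [intervalIntegral.integral_eq_sub_of_hasDerivAt_of_le zero_le_one
      (fun x hx => (hi x hx).continuousWithinAt)
      (fun x hx => (hi x (Set.Ioo_subset_Icc_self hx)).hasDerivAt (Icc_mem_nhds hx.1 hx.2)) hI,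
      hi0, hi1, sub_zero]
  have hs : (∫ x in (0:ℝ)..1, Real.sqrt (i' x ^ 2 + 4 * a x * b x))
      = ∫ x in (0:ℝ)..1, (-2 * (a x * Y x) - i' x) := by
    apply intervalIntegral.integral_congr
    intro x hx
    rw [Set.uIcc_of_le zero_le_one] at hx
    have h1 := haneg x hx
    have h2 := hbneg x hx
    have h3 := hYpos x hx
    have h4 := hquad x hx
    have h5 : a x * Y x < 0 := mul_neg_of_neg_of_pos h1 h3
    have h6 : a x * Y x + i' x < 0 := by
      by_contra hc
      have := mul_nonneg (not_lt.mp hc) h3.le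
      nlinarith
    have h7 : i' x ^ 2 + 4 * a x * b x = (-2 * (a x * Y x) - i' x) ^ 2 := by
      linear_combination (-4 * a x) * h4
    show Real.sqrt (i' x ^ 2 + 4 * a x * b x) = -2 * (a x * Y x) - i' x
    rw [h7, Real.sqrt_sq (by linarith)]
  rw [hs, intervalIntegral.integral_sub (hA.const_mul _) hI, h0,
    intervalIntegral.integral_const_mul]
  constructor <;> intro h <;> linarith
end

section
/- Fix positive constants μ_n, μ_p, Q₀. Let i ∈ C¹([0,1]) with i(0) = i(1) = 0, set I(x) := ∫₀ˣ i(t) dt, and let V⁰ : [0,1] → ℝ be continuous with Y⁰ := e^{−V⁰}. Suppose there exist constants c₁, c₂ such that for all x ∈ [0,1], (c₁ − (Q₀/μ_n) I(x)) Y⁰(x) + i'(x) − (c₂ + (Q₀/μ_p) I(x)) / Y⁰(x) = 0 and 1 + ∫₀¹ (c₁ − (Q₀/μ_n) I) Y⁰ dx = 0, and assume the strict inequalities c₁ < (Q₀/μ_n) · min_{x∈[0,1]} I(x) and c₂ < −(Q₀/μ_p) · max_{x∈[0,1]} I(x). Then there exist ε > 0 and a family of continuous potentials (V_t)_{t ∈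 (−ε,ε)}, V_t : [0,1] → ℝ, with V_0 = V⁰, strictly monotone in the parameter (s < t implies V_s(x) < V_t(x) for all x ∈ [0,1]), such that for each t ∈ (−ε,ε) there exist u_t, v_t ∈ C¹([0,1]) with x ↦ μ_n e^{V_t(x)} u_t'(x) and x ↦ μ_p e^{−V_t(x)} v_t'(x) differentiable, (μ_n e^{V_t} u_t')' = Q₀ (u_t − v_t), (μ_p e^{−V_t} v_t')' = Q₀ (v_t − u_t), u_t(0) = v_t(0) = 1, u_t(1) = v_t(1) = 0, and v_t(x) − u_t(x) = i(x) for all x. -/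
/-- positive root of `a y - b / y = j` -/
noncomputable def lbicRoot (j a b : ℝ) : ℝ := (j + Real.sqrt (j ^ 2 + 4 * (a * b))) / (2 * a)

lemma lbicRoot_pos {j a b : ℝ} (ha : 0 < a) (hb : 0 < b) : 0 < lbicRoot j a b := by
  have hab : 0 < a * b := mul_pos ha hb
  have h : |j| < Real.sqrt (j ^ 2 + 4 * (a * b)) := by
    apply Real.lt_sqrt_of_sq_lt
    rw [sq_abs]; linarith
  have h2 := neg_abs_le j
  unfold lbicRoot
  apply div_pos <;> linarith

lemma lbicRoot_mul {j a b : ℝ} (ha : 0 < a) :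
    a * lbicRoot j a b = (j + Real.sqrt (j ^ 2 + 4 * (a * b))) / 2 := by
  unfold lbicRoot
  field_simp

lemma lbicRoot_eq {j a b : ℝ} (ha : 0 < a) (hb : 0 < b) :
    a * lbicRoot j a b - b / lbicRoot j a b = j := by
  have hab : 0 < a * b := mul_pos ha hb
  have hp := lbicRoot_pos (j := j) ha hb
  have hm := lbicRoot_mul (j := j) (b := b) ha
  have hs := Real.sq_sqrt (show 0 ≤ j ^ 2 + 4 * (a * b) by positivity)
  set y := lbicRoot j a b
  have e : Real.sqrt (j ^ 2 + 4 * (a * b)) = 2 * (a * y) - j := by linarith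
  rw [e] at hs
  have h3 : a * (a * y ^ 2 - j * y - b) = 0 := by nlinarith
  have h4 : a * y ^ 2 - j * y - b = 0 := by
    rcases mul_eq_zero.1 h3 with h | h
    · exact absurd h ha.ne'
    · exact h
  field_simp
  linarith

lemma lbicRoot_lt {j a b a' b' y z : ℝ} (ha : 0 < a) (hb' : 0 < b') (haa : a ≤ a') (hbb : b' ≤ b)
    (hy : 0 < y) (hz : 0 < z) (h1 : a * y - b / y = j) (h2 : a' * z - b' / z = j) :
    z ≤ y := by
  by_contra! h
  have e1 : a * y < a * z := mul_lt_mul_of_pos_left h ha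
  have e2 : a * z ≤ a' * z := mul_le_mul_of_nonneg_right haa hz.le
  have e3 : b' / z < b' / y := div_lt_div_of_pos_left hb' hy h
  have e4 : b' / y ≤ b / y := div_le_div_of_nonneg_right hbb hy.le
  linarith

/-- the constraint functional -/
noncomputable def lbicH (j A B : ℝ → ℝ) (s b : ℝ) : ℝ :=
  ∫ x in (0:ℝ)..1, Real.sqrt (j x ^ 2 + 4 * ((A x + s) * (B x - b)))

lemma lbic_sqrt_cont {j A B : ℝ → ℝ} (hj : Continuous j) (hA : Continuous A) (hB : Continuous B)
    (s b : ℝ) : Continuous (fun x => Real.sqrt (j x ^ 2 + 4 * ((A x + s) * (B x - b)))) := by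
  fun_prop

lemma lbicH_cont {j A B : ℝ → ℝ} (hj : Continuous j) (hA : Continuous A) (hB : Continuous B) :
    Continuous (fun p : ℝ × ℝ => lbicH j A B p.1 p.2) := by
  unfold lbicH
  apply intervalIntegral.continuous_parametric_intervalIntegral_of_continuous'
  unfold Function.uncurry
  fun_prop

lemma lbicH_lt {j A B : ℝ → ℝ} (hj : Continuous j) (hA : Continuous A) (hB : Continuous B)
    {s b s' b' : ℝ} (h : ∀ x, (A x + s) * (B x - b) < (A x + s') * (B x - b'))
    (h0 : ∀ x, 0 ≤ (A x + s) * (B x - b)) :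
    lbicH j A B s b < lbicH j A B s' b' := by
  unfold lbicH
  have key : ∀ x, Real.sqrt (j x ^ 2 + 4 * ((A x + s) * (B x - b))) <
      Real.sqrt (j x ^ 2 + 4 * ((A x + s') * (B x - b'))) := by
    intro x
    have := h0 x
    apply Real.sqrt_lt_sqrt (by positivity)
    have := h x
    linarith
  apply intervalIntegral.integral_lt_integral_of_continuousOn_of_le_of_exists_lt one_pos
  · exact Continuous.continuousOn (by fun_prop)
  · exact Continuous.continuousOn (by fun_prop)
  · intro x _; exact (key x).le
  · exact ⟨0, by simp, key 0⟩

lemma lbic_core {j A B : ℝ → ℝ} (hj : Continuous j) (hA : Continuous A) (hB : Continuous B)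
    {m : ℝ} (hm : 0 < m) (hAm : ∀ x, m ≤ A x) (hBm : ∀ x, m ≤ B x) (h2 : lbicH j A B 0 0 = 2) :
    ∃ ε > (0:ℝ), ∃ β : ℝ → ℝ, β 0 = 0 ∧
      (∀ s ∈ Set.Ioo (-ε) ε, (∀ x, 0 < A x + s) ∧ (∀ x, 0 < B x - β s) ∧
        lbicH j A B s (β s) = 2) ∧
      (∀ s ∈ Set.Ioo (-ε) ε, ∀ t ∈ Set.Ioo (-ε) ε, s < t → β s ≤ β t) := by
  have hc := lbicH_cont hj hA hB
  have l1 : lbicH j A B 0 (m/2) < 2 := by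
    refine lt_of_lt_of_eq (lbicH_lt hj hA hB ?_ ?_) h2
    · intro x
      have := hAm x; have := hBm x
      apply mul_lt_mul_of_pos_left <;> linarith
    · intro x
      have := hAm x; have := hBm x
      apply mul_nonneg <;> linarith
  have l2 : 2 < lbicH j A B 0 (-(m/2)) := by
    refine lt_of_eq_of_lt h2.symm (lbicH_lt hj hA hB ?_ ?_)
    · intro x
      have := hAm x; have := hBm x
      apply mul_lt_mul_of_pos_left <;> linarith
    · intro x
      have := hAm x; have := hBm x
      apply mul_nonneg <;> linarith
  have c1 : Continuous (fun s => lbicH j A B s (m/2)) :=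
    hc.comp (f := fun s : ℝ => (s, m/2)) (by fun_prop)
  have c2 : Continuous (fun s => lbicH j A B s (-(m/2))) :=
    hc.comp (f := fun s : ℝ => (s, -(m/2))) (by fun_prop)
  have e1 := c1.continuousAt.eventually_lt (x₀ := 0) continuousAt_const l1
  have e2 := (continuousAt_const (x := (0:ℝ))).eventually_lt c2.continuousAt l2
  obtain ⟨δ, hδ, hball⟩ := Metric.eventually_nhds_iff.1 (e1.and e2)
  have ex : ∀ s : ℝ, ∃ b : ℝ, (s = 0 → b = 0) ∧ (s ∈ Set.Ioo (-(min δ (m/2))) (min δ (m/2)) →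
      b ∈ Set.Icc (-(m/2)) (m/2) ∧ lbicH j A B s b = 2) := by
    intro s
    by_cases h0 : s = 0
    · subst h0
      exact ⟨0, fun _ => rfl, fun _ => ⟨⟨by linarith, by linarith⟩, h2⟩⟩
    by_cases hs : s ∈ Set.Ioo (-(min δ (m/2))) (min δ (m/2))
    · have hd : dist s 0 < δ := by
        rw [Real.dist_eq, sub_zero, abs_lt]
        have := min_le_left δ (m/2)
        exact ⟨by linarith [hs.1], by linarith [hs.2]⟩
      obtain ⟨q1, q2⟩ := hball hd
      have c3 : Continuous (fun b => lbicH j A B s b) :=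
        hc.comp (f := fun b : ℝ => (s, b)) (by fun_prop)
      have iv := intermediate_value_Icc' (show -(m/2) ≤ m/2 by linarith) c3.continuousOn
      obtain ⟨b, hb, hb2⟩ := iv ⟨q1.le, q2.le⟩
      exact ⟨b, fun h => absurd h h0, fun _ => ⟨hb, hb2⟩⟩
    · exact ⟨0, fun _ => rfl, fun h => absurd h hs⟩
  choose β hβ0 hβ using ex
  have hpos : ∀ s ∈ Set.Ioo (-(min δ (m/2))) (min δ (m/2)),
      (∀ x, 0 < A x + s) ∧ (∀ x, 0 < B x - β s) := by
    intro s hs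
    have := min_le_right δ (m/2)
    have hb := (hβ s hs).1
    refine ⟨fun x => ?_, fun x => ?_⟩
    · linarith [hs.1, hAm x]
    · linarith [hb.2, hBm x]
  refine ⟨min δ (m/2), by positivity, β, hβ0 0 rfl, fun s hs => ⟨(hpos s hs).1, (hpos s hs).2,
    (hβ s hs).2⟩, ?_⟩
  intro s hs t ht hst
  by_contra! hlt
  have := lbicH_lt (s := s) (b := β s) (s' := t) (b' := β t) hj hA hB (fun x => by
    have p1 := (hpos s hs).1 x
    have p2 := (hpos s hs).2 x
    apply mul_lt_mul'' <;> linarith) (fun x => by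
    have p1 := (hpos s hs).1 x
    have p2 := (hpos s hs).2 x
    positivity)
  rw [(hβ s hs).2, (hβ t ht).2] at this
  exact lt_irrefl _ this



/-- Nonuniqueness for the 1-D LBIC inverse problem: under the strict inequalities
`c₁ < (Q₀/μ_n) min I` and `c₂ < -(Q₀/μ_p) max I`, there is a one-parameter strictly
monotone family of continuous potentials containing `V⁰` that all produce the same
measurement `i` through the LBIC system. -/
theorem lbic_nonuniqueness (μn μp Q0 : ℝ)
    (hμn : 0 < μn) (hμp : 0 < μp) (hQ0 : 0 < Q0)
    (i i' : ℝ → ℝ)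
    (hi : ∀ x ∈ Set.Icc (0:ℝ) 1, HasDerivWithinAt i (i' x) (Set.Icc 0 1) x)
    (hi'c : ContinuousOn i' (Set.Icc 0 1))
    (hi0 : i 0 = 0) (hi1 : i 1 = 0)
    (V0 : ℝ → ℝ) (hV0 : ContinuousOn V0 (Set.Icc 0 1))
    (c1 c2 : ℝ)
    (hquad : ∀ x ∈ Set.Icc (0:ℝ) 1,
      (c1 - Q0 / μn * ∫ t in (0:ℝ)..x, i t) * Real.exp (-V0 x) + i' x
        - (c2 + Q0 / μp * ∫ t in (0:ℝ)..x, i t) / Real.exp (-V0 x) = 0)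
    (hint : 1 + (∫ x in (0:ℝ)..1,
      (c1 - Q0 / μn * ∫ t in (0:ℝ)..x, i t) * Real.exp (-V0 x)) = 0)
    (hc1 : ∀ x ∈ Set.Icc (0:ℝ) 1, c1 < Q0 / μn * ∫ t in (0:ℝ)..x, i t)
    (hc2 : ∀ x ∈ Set.Icc (0:ℝ) 1, c2 < -(Q0 / μp) * ∫ t in (0:ℝ)..x, i t) :
    ∃ ε > (0:ℝ), ∃ Vfam : ℝ → ℝ → ℝ,
      (∀ x ∈ Set.Icc (0:ℝ) 1, Vfam 0 x = V0 x) ∧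
      (∀ t ∈ Set.Ioo (-ε) ε, ContinuousOn (Vfam t) (Set.Icc 0 1)) ∧
      (∀ s ∈ Set.Ioo (-ε) ε, ∀ t ∈ Set.Ioo (-ε) ε, s < t →
        ∀ x ∈ Set.Icc (0:ℝ) 1, Vfam s x < Vfam t x) ∧
      (∀ t ∈ Set.Ioo (-ε) ε, ∃ u v u' v' : ℝ → ℝ,
        (∀ x ∈ Set.Icc (0:ℝ) 1, HasDerivWithinAt u (u' x) (Set.Icc 0 1) x) ∧
        (∀ x ∈ Set.Icc (0:ℝ) 1, HasDerivWithinAt v (v' x) (Set.Icc 0 1) x) ∧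
        ContinuousOn u' (Set.Icc 0 1) ∧ ContinuousOn v' (Set.Icc 0 1) ∧
        (∀ x ∈ Set.Icc (0:ℝ) 1,
          HasDerivWithinAt (fun s => μn * Real.exp (Vfam t s) * u' s)
            (Q0 * (u x - v x)) (Set.Icc 0 1) x) ∧
        (∀ x ∈ Set.Icc (0:ℝ) 1,
          HasDerivWithinAt (fun s => μp * Real.exp (-Vfam t s) * v' s)
            (Q0 * (v x - u x)) (Set.Icc 0 1) x) ∧
        u 0 = 1 ∧ v 0 = 1 ∧ u 1 = 0 ∧ v 1 = 0 ∧
        (∀ x ∈ Set.Icc (0:ℝ) 1, v x - u x = i x)) := by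
  have h01 : (0:ℝ) ≤ 1 := zero_le_one
  have hic : ContinuousOn i (Set.Icc 0 1) := fun x hx => (hi x hx).continuousWithinAt
  -- clamping to the unit interval
  obtain ⟨c, hcc, hcm, hcid⟩ : ∃ c : ℝ → ℝ, Continuous c ∧ (∀ x, c x ∈ Set.Icc (0:ℝ) 1) ∧
      ∀ x ∈ Set.Icc (0:ℝ) 1, c x = x := by
    refine ⟨fun x => max 0 (min 1 x), by fun_prop, fun x => ⟨le_max_left _ _, ?_⟩, ?_⟩
    · exact max_le h01 (min_le_left _ _)
    · intro x hx
      simp [hx.1, hx.2]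
  have hie : Continuous (fun x => i (c x)) := hic.comp_continuous hcc hcm
  have hj : Continuous (fun x => i' (c x)) := hi'c.comp_continuous hcc hcm
  obtain ⟨I, hI⟩ : ∃ I : ℝ → ℝ, ∀ x, I x = ∫ t in (0:ℝ)..x, i (c t) := ⟨_, fun _ => rfl⟩
  have hId : ∀ x, HasDerivAt I (i (c x)) x := by
    intro x
    have := intervalIntegral.integral_hasDerivAt_right (hie.intervalIntegrable 0 x)
      (hie.stronglyMeasurableAtFilter _ _) hie.continuousAt
    exact this.congr_of_eventuallyEq (Filter.Eventually.of_forall hI)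
  have hIeq : ∀ x ∈ Set.Icc (0:ℝ) 1, (∫ t in (0:ℝ)..x, i t) = I x := by
    intro x hx
    rw [hI]
    apply intervalIntegral.integral_congr
    intro t ht
    rw [Set.uIcc_of_le hx.1] at ht
    simp only
    rw [hcid t ⟨ht.1, ht.2.trans hx.2⟩]
  have hIc : Continuous I := continuous_iff_continuousAt.2 fun x => (hId x).continuousAt
  obtain ⟨A, hA⟩ : ∃ A : ℝ → ℝ, ∀ x, A x = Q0 / μn * I (c x) - c1 := ⟨_, fun _ => rfl⟩
  obtain ⟨B, hB⟩ : ∃ B : ℝ → ℝ, ∀ x, B x = -(c2 + Q0 / μp * I (c x)) := ⟨_, fun _ => rfl⟩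
  have hAc : Continuous A := by
    rw [show A = _ from funext hA]; fun_prop
  have hBc : Continuous B := by
    rw [show B = _ from funext hB]; fun_prop
  have hA0 : ∀ x, 0 < A x := by
    intro x
    have := hc1 (c x) (hcm x)
    rw [hIeq _ (hcm x)] at this
    rw [hA]; linarith
  have hB0 : ∀ x, 0 < B x := by
    intro x
    have := hc2 (c x) (hcm x)
    rw [hIeq _ (hcm x)] at this
    rw [hB]; linarith
  have hAcl : ∀ x, A (c x) = A x := fun x => by rw [hA, hA, hcid _ (hcm x)]
  have hBcl : ∀ x, B (c x) = B x := fun x => by rw [hB, hB, hcid _ (hcm x)]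
  obtain ⟨m, hm, hAm, hBm⟩ : ∃ m > 0, (∀ x, m ≤ A x) ∧ ∀ x, m ≤ B x := by
    obtain ⟨a, -, ha⟩ := isCompact_Icc.exists_isMinOn (Set.nonempty_Icc.2 h01) hAc.continuousOn
    obtain ⟨b, -, hb⟩ := isCompact_Icc.exists_isMinOn (Set.nonempty_Icc.2 h01) hBc.continuousOn
    refine ⟨min (A a) (B b), lt_min (hA0 a) (hB0 b), fun x => ?_, fun x => ?_⟩
    · rw [← hAcl x]
      exact (min_le_left _ _).trans (ha (hcm x))
    · rw [← hBcl x]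
      exact (min_le_right _ _).trans (hb (hcm x))
  -- `∫ i' = 0`
  have hj0 : (∫ x in (0:ℝ)..1, i' (c x)) = 0 := by
    rw [intervalIntegral.integral_eq_sub_of_hasDerivAt_of_le (f := i) h01 hic ?_
      (hj.intervalIntegrable 0 1), hi0, hi1, sub_zero]
    intro x hx
    have hx' := Set.Ioo_subset_Icc_self hx
    rw [hcid x hx']
    exact (hi x hx').hasDerivAt (Icc_mem_nhds hx.1 hx.2)
  have hV : ∀ x ∈ Set.Icc (0:ℝ) 1, Real.exp (-V0 x) = lbicRoot (i' (c x)) (A x) (B x) := by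
    intro x hx
    have q := hquad x hx
    rw [hIeq x hx] at q
    have p := Real.exp_pos (-V0 x)
    have q1 : A x * Real.exp (-V0 x) - B x / Real.exp (-V0 x) = i' (c x) := by
      rw [hA, hB, hcid x hx, neg_div]; linarith
    have q2 := lbicRoot_eq (j := i' (c x)) (hA0 x) (hB0 x)
    have p2 := lbicRoot_pos (j := i' (c x)) (hA0 x) (hB0 x)
    exact le_antisymm (lbicRoot_lt (hA0 x) (hB0 x) le_rfl le_rfl p2 p q2 q1)
      (lbicRoot_lt (hA0 x) (hB0 x) le_rfl le_rfl p p2 q1 q2)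
  -- integral of `A * Y` in terms of the functional
  have hAY : ∀ s b : ℝ, (∀ x, 0 < A x + s) →
      (∫ x in (0:ℝ)..1, (A x + s) * lbicRoot (i' (c x)) (A x + s) (B x - b)) =
      lbicH (fun x => i' (c x)) A B s b / 2 := by
    intro s b hs
    have : ∀ x, (A x + s) * lbicRoot (i' (c x)) (A x + s) (B x - b) =
        (i' (c x) + Real.sqrt (i' (c x) ^ 2 + 4 * ((A x + s) * (B x - b)))) / 2 :=
      fun x => lbicRoot_mul (hs x)
    simp_rw [this]
    rw [intervalIntegral.integral_div, intervalIntegral.integral_add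
      (hj.intervalIntegrable 0 1) ((lbic_sqrt_cont hj hAc hBc s b).intervalIntegrable 0 1), hj0, zero_add]
    rfl
  have hH2 : lbicH (fun x => i' (c x)) A B 0 0 = 2 := by
    have h := hAY 0 0 (fun x => by simpa using hA0 x)
    have e : (∫ x in (0:ℝ)..1, (c1 - Q0 / μn * ∫ t in (0:ℝ)..x, i t) * Real.exp (-V0 x)) =
        -∫ x in (0:ℝ)..1, (A x + 0) * lbicRoot (i' (c x)) (A x + 0) (B x - 0) := by
      rw [← intervalIntegral.integral_neg]
      apply intervalIntegral.integral_congr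
      intro x hx
      rw [Set.uIcc_of_le h01] at hx
      simp only [add_zero, sub_zero]
      rw [← hV x hx, hIeq x hx, hA, hcid x hx]
      ring
    rw [e] at hint
    linarith
  obtain ⟨ε, hε, β, hβ0, hβ, hmono⟩ := lbic_core hj hAc hBc hm hAm hBm hH2
  obtain ⟨Y, hY⟩ : ∃ Y : ℝ → ℝ → ℝ, ∀ t x, Y t x =
    lbicRoot (i' (c x)) (A x + t) (B x - β t) := ⟨_, fun _ _ => rfl⟩
  have hYpos : ∀ t ∈ Set.Ioo (-ε) ε, ∀ x, 0 < Y t x := by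
    intro t ht x
    rw [hY]
    exact lbicRoot_pos ((hβ t ht).1 x) ((hβ t ht).2.1 x)
  have hYc : ∀ t ∈ Set.Ioo (-ε) ε, Continuous (Y t) := by
    intro t ht
    rw [show Y t = _ from funext (hY t)]
    unfold lbicRoot
    apply Continuous.div (hj.add (lbic_sqrt_cont hj hAc hBc t (β t))) (by fun_prop)
    intro x
    have := (hβ t ht).1 x
    positivity
  have hYe : ∀ t ∈ Set.Ioo (-ε) ε, ∀ x,
      (A x + t) * Y t x - (B x - β t) / Y t x = i' (c x) := by
    intro t ht x
    rw [hY]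
    exact lbicRoot_eq ((hβ t ht).1 x) ((hβ t ht).2.1 x)
  have hmem0 : (0:ℝ) ∈ Set.Ioo (-ε) ε := ⟨by linarith, hε⟩
  have hAd : ∀ x ∈ Set.Icc (0:ℝ) 1, HasDerivWithinAt A (Q0 / μn * i x) (Set.Icc 0 1) x := by
    intro x hx
    have h := (((hId x).const_mul (Q0 / μn)).sub_const c1).hasDerivWithinAt (s := Set.Icc 0 1)
    rw [hcid x hx] at h
    exact h.congr (fun y hy => by rw [hA, hcid y hy]) (by rw [hA, hcid x hx])
  have hBd : ∀ x ∈ Set.Icc (0:ℝ) 1, HasDerivWithinAt B (-(Q0 / μp * i x)) (Set.Icc 0 1) x := by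
    intro x hx
    have h := (((hId x).const_mul (Q0 / μp)).const_add c2).neg.hasDerivWithinAt (s := Set.Icc 0 1)
    rw [hcid x hx] at h
    exact h.congr (fun y hy => by rw [hB, hcid y hy]; rfl) (by rw [hB, hcid x hx]; rfl)
  refine ⟨ε, hε, fun t x => -Real.log (Y t x), ?_, ?_, ?_, ?_⟩
  · intro x hx
    simp only [hY, hβ0, add_zero, sub_zero]
    rw [← hV x hx, Real.log_exp, neg_neg]
  · intro t ht
    exact ((hYc t ht).log fun x => (hYpos t ht x).ne').neg.continuousOn
  · intro s hs t ht hst x _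
    apply neg_lt_neg
    apply Real.log_lt_log (hYpos t ht x)
    have hle := lbicRoot_lt ((hβ s hs).1 x) ((hβ t ht).2.1 x) (by linarith)
      (by linarith [hmono s hs t ht hst]) (hYpos s hs x) (hYpos t ht x) (hYe s hs x) (hYe t ht x)
    refine lt_of_le_of_ne hle fun heq => ?_
    have e1 := hYe s hs x
    have e2 := hYe t ht x
    rw [heq] at e2
    have p := hYpos s hs x
    have e3 : (A x + s) * Y s x < (A x + t) * Y s x := mul_lt_mul_of_pos_right (by linarith) p
    have e4 : (B x - β t) / Y s x ≤ (B x - β s) / Y s x :=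
      div_le_div_of_nonneg_right (by linarith [hmono s hs t ht hst]) p.le
    linarith
  · intro t ht
    have hwc : Continuous (fun x => -((A x + t) * Y t x)) := by
      have := hYc t ht
      fun_prop
    obtain ⟨u, hu⟩ : ∃ u : ℝ → ℝ, ∀ x, u x = 1 + ∫ y in (0:ℝ)..x, -((A y + t) * Y t y) :=
      ⟨_, fun _ => rfl⟩
    have hud : ∀ x, HasDerivAt u (-((A x + t) * Y t x)) x := by
      intro x
      have := (intervalIntegral.integral_hasDerivAt_right (hwc.intervalIntegrable 0 x)
        (hwc.stronglyMeasurableAtFilter _ _) hwc.continuousAt).const_add 1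
      exact this.congr_of_eventuallyEq (Filter.Eventually.of_forall hu)
    have hu0 : u 0 = 1 := by rw [hu]; simp
    have hu1 : u 1 = 0 := by
      have h := hAY t (β t) (hβ t ht).1
      rw [(hβ t ht).2.2] at h
      simp only [← hY] at h
      rw [hu, intervalIntegral.integral_neg, h]
      norm_num
    refine ⟨u, fun x => u x + i x, fun x => -((A x + t) * Y t x),
      fun x => -((B x - β t) / Y t x), fun x _ => (hud x).hasDerivWithinAt, ?_,
      hwc.continuousOn, ?_, ?_, ?_, hu0, by simp [hu0, hi0], hu1, by simp [hu1, hi1],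
      fun x _ => by ring⟩
    · intro x hx
      have h := (hud x).hasDerivWithinAt (s := Set.Icc 0 1) |>.add (hi x hx)
      have e := hYe t ht x
      rw [hcid x hx] at e
      have e' : -((B x - β t) / Y t x) = -((A x + t) * Y t x) + i' x := by linarith
      simp only [e']
      exact h
    · exact (((hBc.sub continuous_const).div (hYc t ht) fun x => (hYpos t ht x).ne').neg).continuousOn
    · intro x hx
      have h := ((hAd x hx).add_const t).const_mul (-μn)
      have ev : -μn * (Q0 / μn * i x) = Q0 * (u x - (u x + i x)) := by
        field_simp
        ring
      rw [ev] at h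
      have ef : ∀ y, μn * Real.exp (- Real.log (Y t y)) * -((A y + t) * Y t y) =
          -μn * (A y + t) := by
        intro y
        have p := hYpos t ht y
        rw [Real.exp_neg, Real.exp_log p]
        field_simp
      exact h.congr (fun y _ => ef y) (ef x)
    · intro x hx
      have h := ((hBd x hx).sub_const (β t)).const_mul (-μp)
      have ev : -μp * -(Q0 / μp * i x) = Q0 * ((u x + i x) - u x) := by
        field_simp
        ring
      rw [ev] at h
      have ef : ∀ y, μp * Real.exp (- - Real.log (Y t y)) * -((B y - β t) / Y t y) =
          -μp * (B y - β t) := by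
        intro y
        have p := hYpos t ht y
        rw [neg_neg, Real.exp_log p]
        field_simp
      exact h.congr (fun y _ => ef y) (ef x)
end

section
/- Fix positive constants μ_n, μ_p, Q₀ and a continuous potential V : [0,1] → ℝ. Let ũ, ṽ ∈ C¹([0,1]) be such that x ↦ μ_n e^{V(x)} ũ'(x) and x ↦ μ_p e^{−V(x)} ṽ'(x) are differentiable on [0,1] with (μ_n e^{V} ũ')' = Q₀ (ũ − ṽ) and (μ_p e^{−V} ṽ')' = Q₀ (ṽ − ũ), and ũ(0) = ṽ(0) = 1, ũ(1) = ṽ(1) = 0. Then the measurement i := ṽ − ũ is identically zero on [0,1] if and only if V is constant on [0,1]. -/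
theorem const_aux (f : ℝ → ℝ)
    (hf : ∀ x ∈ Set.Icc (0:ℝ) 1, HasDerivWithinAt f 0 (Set.Icc 0 1) x) :
    ∀ x ∈ Set.Icc (0:ℝ) 1, f x = f 0 := by
  apply constant_of_derivWithin_zero
  · intro x hx
    exact (hf x hx).differentiableWithinAt
  · intro x hx
    have hx' : x ∈ Set.Icc (0:ℝ) 1 := ⟨hx.1, hx.2.le⟩
    exact (hf x hx').derivWithin (uniqueDiffOn_Icc one_pos x hx')

/-- First identifiability result for 1-D LBIC measurements: the LBIC image
`i = ṽ - ũ` vanishes identically on `[0,1]` if and only if the equilibrium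
potential `V` is constant on `[0,1]`. -/
theorem lbic_zero_measurement_iff_constant_potential (μn μp Q0 : ℝ)
    (hμn : 0 < μn) (hμp : 0 < μp) (hQ0 : 0 < Q0)
    (V : ℝ → ℝ) (hV : ContinuousOn V (Set.Icc 0 1))
    (tu tv tu' tv' : ℝ → ℝ)
    (htu : ∀ x ∈ Set.Icc (0:ℝ) 1, HasDerivWithinAt tu (tu' x) (Set.Icc 0 1) x)
    (htv : ∀ x ∈ Set.Icc (0:ℝ) 1, HasDerivWithinAt tv (tv' x) (Set.Icc 0 1) x)
    (htu' : ContinuousOn tu' (Set.Icc 0 1)) (htv' : ContinuousOn tv' (Set.Icc 0 1))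
    (hJtu : ∀ x ∈ Set.Icc (0:ℝ) 1,
      HasDerivWithinAt (fun t => μn * Real.exp (V t) * tu' t)
        (Q0 * (tu x - tv x)) (Set.Icc 0 1) x)
    (hJtv : ∀ x ∈ Set.Icc (0:ℝ) 1,
      HasDerivWithinAt (fun t => μp * Real.exp (-V t) * tv' t)
        (Q0 * (tv x - tu x)) (Set.Icc 0 1) x)
    (htu0 : tu 0 = 1) (htv0 : tv 0 = 1) (htu1 : tu 1 = 0) (htv1 : tv 1 = 0) :
    (∀ x ∈ Set.Icc (0:ℝ) 1, tv x - tu x = 0) ↔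
      (∃ c : ℝ, ∀ x ∈ Set.Icc (0:ℝ) 1, V x = c) := by
  have h0 : (0:ℝ) ∈ Set.Icc (0:ℝ) 1 := by simp
  have h1 : (1:ℝ) ∈ Set.Icc (0:ℝ) 1 := by simp
  have hU : UniqueDiffOn ℝ (Set.Icc (0:ℝ) 1) := uniqueDiffOn_Icc one_pos
  constructor
  · intro hi
    have heq : ∀ x ∈ Set.Icc (0:ℝ) 1, tv' x = tu' x := by
      intro x hx
      have h := (htu x hx).congr (f₁ := tv) (fun y hy => by linarith [hi y hy])
        (by linarith [hi x hx])
      exact (hU x hx).eq_deriv _ (htv x hx) h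
    have hA := const_aux _ (fun x hx => by
      have h := hJtu x hx
      rwa [show Q0 * (tu x - tv x) = 0 by rw [show tu x - tv x = 0 by linarith [hi x hx]]; simp] at h)
    have hB := const_aux _ (fun x hx => by
      have h := hJtv x hx
      rwa [show Q0 * (tv x - tu x) = 0 by rw [hi x hx]; simp] at h)
    have ht0 : tu' 0 ≠ 0 := by
      intro hz
      have h := const_aux tu (fun x hx => by
        have h := hA x hx
        simp only [hz, mul_zero] at h
        have h2 : tu' x = 0 := by
          have : μn * Real.exp (V x) ≠ 0 := by positivity
          simpa [this] using h
        exact (htu x hx).congr_deriv h2) 1 h1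
      rw [htu0, htu1] at h
      norm_num at h
    refine ⟨V 0, fun x hx => ?_⟩
    have a := hA x hx
    have b := hB x hx
    simp only [heq x hx, heq 0 h0] at a b
    have a' : Real.exp (V x) * tu' x = Real.exp (V 0) * tu' 0 :=
      mul_left_cancel₀ hμn.ne' (by linarith)
    have b' : Real.exp (-V x) * tu' x = Real.exp (-V 0) * tu' 0 :=
      mul_left_cancel₀ hμp.ne' (by linarith)
    have htx : tu' x ≠ 0 := by
      intro hz
      rw [hz, mul_zero] at a'
      exact (mul_ne_zero (Real.exp_pos _).ne' ht0) a'.symm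
    have hc : Real.exp (V x) * Real.exp (-V 0) = Real.exp (V 0) * Real.exp (-V x) := by
      apply mul_right_cancel₀ (mul_ne_zero htx ht0)
      calc _ = (Real.exp (V x) * tu' x) * (Real.exp (-V 0) * tu' 0) := by ring
        _ = (Real.exp (V 0) * tu' 0) * (Real.exp (-V x) * tu' x) := by rw [a', b']
        _ = _ := by ring
    rw [← Real.exp_add, ← Real.exp_add, Real.exp_eq_exp] at hc
    linarith
  · rintro ⟨c, hc⟩
    have hu2 : ∀ x ∈ Set.Icc (0:ℝ) 1, HasDerivWithinAt tu'
        ((Q0 * (tu x - tv x)) / (μn * Real.exp c)) (Set.Icc 0 1) x := by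
      intro x hx
      have hp : μn * Real.exp c ≠ 0 := by positivity
      refine ((hJtu x hx).div_const (μn * Real.exp c)).congr (fun y hy => ?_) ?_
      · rw [hc y hy]; field_simp
      · rw [hc x hx]; field_simp
    have hv2 : ∀ x ∈ Set.Icc (0:ℝ) 1, HasDerivWithinAt tv'
        ((Q0 * (tv x - tu x)) / (μp * Real.exp (-c))) (Set.Icc 0 1) x := by
      intro x hx
      have hp : μp * Real.exp (-c) ≠ 0 := by positivity
      refine ((hJtv x hx).div_const (μp * Real.exp (-c))).congr (fun y hy => ?_) ?_
      · rw [hc y hy, mul_div_cancel_left₀ _ hp]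
      · rw [hc x hx, mul_div_cancel_left₀ _ hp]
    obtain ⟨K, hK, hKe⟩ : ∃ K : ℝ, 0 < K ∧
        K = Q0 / (μn * Real.exp c) + Q0 / (μp * Real.exp (-c)) := ⟨_, by positivity, rfl⟩
    have hG : ∀ x ∈ Set.Icc (0:ℝ) 1,
        HasDerivWithinAt (fun t => (tu t - tv t) * (tu' t - tv' t))
          ((tu' x - tv' x) ^ 2 + K * (tu x - tv x) ^ 2) (Set.Icc 0 1) x := by
      intro x hx
      have h := ((htu x hx).sub (htv x hx)).mul ((hu2 x hx).sub (hv2 x hx))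
      refine h.congr_deriv ?_
      simp only [Pi.sub_apply]
      rw [hKe]; ring
    have hmono : MonotoneOn (fun t => (tu t - tv t) * (tu' t - tv' t)) (Set.Icc (0:ℝ) 1) := by
      refine monotoneOn_of_hasDerivWithinAt_nonneg (convex_Icc 0 1)
        (fun x hx => (hG x hx).continuousWithinAt)
        (fun x hx => (hG x (interior_subset hx)).mono interior_subset)
        (fun x hx => by positivity)
    have hz : ∀ x ∈ Set.Icc (0:ℝ) 1, (tu x - tv x) * (tu' x - tv' x) = 0 := by
      intro x hx
      have l := hmono h0 hx hx.1
      have r := hmono hx h1 hx.2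
      simp only [htu0, htv0, htu1, htv1, sub_self, zero_mul] at l r
      exact le_antisymm r l
    intro x hx
    have hd : HasDerivWithinAt (fun t => (tu t - tv t) * (tu' t - tv' t)) 0 (Set.Icc 0 1) x :=
      (hasDerivWithinAt_const x _ (0:ℝ)).congr hz (hz x hx)
    have he := (hU x hx).eq_deriv _ (hG x hx) hd
    have hw : (tu x - tv x) ^ 2 = 0 := by
      have p1 := sq_nonneg (tu' x - tv' x)
      have p2 := sq_nonneg (tu x - tv x)
      by_contra hne
      have := mul_pos hK (lt_of_le_of_ne p2 (Ne.symm hne))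
      linarith
    have := pow_eq_zero_iff (two_ne_zero) |>.mp hw
    linarith
end

section
/- Let a : [0,1] → ℝ be continuous and positive, h : [0,1] → ℝ continuous, and z, g₀, g₁ real numbers. Let G, ψ, Φ ∈ C¹([0,1]) satisfy: x ↦ a(x) G'(x) is constant on [0,1] with G(0) = g₀, G(1) = g₁; x ↦ a(x) ψ'(x) + h(x) G'(x) is constant on [0,1] with ψ(0) = ψ(1) = 0; and x ↦ a(x) Φ'(x) is constant on [0,1] with Φ(0) = z, Φ(1) = 0. Then −z · ( h(0) G'(0) + a(0) ψ'(0) ) = ∫₀¹ h(x) G'(x) Φ'(x) dx. -/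
/-- One-dimensional adjoint identity for the Landweber–Kaczmarz iteration:
if `aG'` is constant with `G(0) = g₀`, `G(1) = g₁`; `aψ' + hG'` is constant with
`ψ(0) = ψ(1) = 0`; and `aΦ'` is constant with `Φ(0) = z`, `Φ(1) = 0`, then
`-z (h(0)G'(0) + a(0)ψ'(0)) = ∫₀¹ h G' Φ'`. -/
theorem adjoint_identity_1d (a h : ℝ → ℝ) (z g0 g1 : ℝ)
    (ha : ContinuousOn a (Set.Icc 0 1))
    (hapos : ∀ x ∈ Set.Icc (0:ℝ) 1, 0 < a x)
    (hh : ContinuousOn h (Set.Icc 0 1))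
    (G ψ Φ G' ψ' Φ' : ℝ → ℝ)
    (hG : ∀ x ∈ Set.Icc (0:ℝ) 1, HasDerivWithinAt G (G' x) (Set.Icc 0 1) x)
    (hψ : ∀ x ∈ Set.Icc (0:ℝ) 1, HasDerivWithinAt ψ (ψ' x) (Set.Icc 0 1) x)
    (hΦ : ∀ x ∈ Set.Icc (0:ℝ) 1, HasDerivWithinAt Φ (Φ' x) (Set.Icc 0 1) x)
    (hG' : ContinuousOn G' (Set.Icc 0 1))
    (hψ' : ContinuousOn ψ' (Set.Icc 0 1))
    (hΦ' : ContinuousOn Φ' (Set.Icc 0 1))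
    (hGflux : ∀ x ∈ Set.Icc (0:ℝ) 1, ∀ y ∈ Set.Icc (0:ℝ) 1,
      a x * G' x = a y * G' y)
    (hG0 : G 0 = g0) (hG1 : G 1 = g1)
    (hψflux : ∀ x ∈ Set.Icc (0:ℝ) 1, ∀ y ∈ Set.Icc (0:ℝ) 1,
      a x * ψ' x + h x * G' x = a y * ψ' y + h y * G' y)
    (hψ0 : ψ 0 = 0) (hψ1 : ψ 1 = 0)
    (hΦflux : ∀ x ∈ Set.Icc (0:ℝ) 1, ∀ y ∈ Set.Icc (0:ℝ) 1,
      a x * Φ' x = a y * Φ' y)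
    (hΦ0 : Φ 0 = z) (hΦ1 : Φ 1 = 0) :
    -z * (h 0 * G' 0 + a 0 * ψ' 0) = ∫ x in (0:ℝ)..1, h x * G' x * Φ' x := by
  have h0 : (0:ℝ) ∈ Set.Icc (0:ℝ) 1 := by simp
  have key : ∫ x in (0:ℝ)..1, h x * G' x * Φ' x =
      ((h 0 * G' 0 + a 0 * ψ' 0) * Φ 1 - a 0 * Φ' 0 * ψ 1) -
      ((h 0 * G' 0 + a 0 * ψ' 0) * Φ 0 - a 0 * Φ' 0 * ψ 0) := by
    refine intervalIntegral.integral_eq_sub_of_hasDerivAt_of_le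
      (f := fun x => (h 0 * G' 0 + a 0 * ψ' 0) * Φ x - a 0 * Φ' 0 * ψ x) zero_le_one ?_ ?_ ?_
    · have c1 : ContinuousOn Φ (Set.Icc 0 1) := fun x hx => (hΦ x hx).continuousWithinAt
      have c2 : ContinuousOn ψ (Set.Icc 0 1) := fun x hx => (hψ x hx).continuousWithinAt
      fun_prop
    · intro x hx
      have hx' := Set.Ioo_subset_Icc_self hx
      have hn := Icc_mem_nhds hx.1 hx.2
      have d := (((hΦ x hx').hasDerivAt hn).const_mul (h 0 * G' 0 + a 0 * ψ' 0)).sub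
        (((hψ x hx').hasDerivAt hn).const_mul (a 0 * Φ' 0))
      have e : h x * G' x * Φ' x =
          (h 0 * G' 0 + a 0 * ψ' 0) * Φ' x - a 0 * Φ' 0 * ψ' x := by
        linear_combination Φ' x * hψflux x hx' 0 h0 - ψ' x * hΦflux x hx' 0 h0
      rw [e]
      exact d
    · apply ContinuousOn.intervalIntegrable
      rw [Set.uIcc_of_le zero_le_one]
      exact (hh.mul hG').mul hΦ'
  rw [key, hΦ0, hΦ1, hψ0, hψ1]
  ring
end
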